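/- Let w : [0,T) → ℝ^N with T ∈ (0,∞] be a regular reparametrized gradient flow under Assumptions (B1), (A2), (A3), (B2), and let F(z̃) = ⟨1, H(z̃)⟩ with H, h, h' as induced by ρ_rp, and D_F the associated Bregman divergence. Then D_F(z̃₀, w̃₀) < ∞ and for all t ∈ (0,T) one has 𝓛̃(w̃(t)) ≤ D_F(z̃₀, w̃₀) / t, where z̃₀ ∈ D_rp^N satisfies A z̃₀ = y. In particular, if T = ∞ then lim_{t→∞} 𝓛̃(w̃(t)) = 0. -/

import Mathlib

open Filter Topology Set
open scoped ENNReal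

noncomputable section

/-- Euclidean gradient of `f : ℝ^k → ℝ`: coordinatewise the Fréchet derivative applied to
the standard basis vectors. -/
def grad {k : ℕ} (f : (Fin k → ℝ) → ℝ) (x : Fin k → ℝ) : Fin k → ℝ :=
  fun i => fderiv ℝ f x (Pi.single i 1)

/-- `w` solves the gradient-flow ODE `w' = -∇F(w)` on `[0, T)`, where `T ∈ (0, ∞]` is coded
as an element of `ℝ≥0∞`. -/
def IsGradFlowOn {k : ℕ} (F : (Fin k → ℝ) → ℝ) (T : ℝ≥0∞) (w : ℝ → Fin k → ℝ) : Prop :=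
  ∀ t : ℝ, 0 ≤ t → ENNReal.ofReal t < T →
    HasDerivWithinAt w (-(grad F (w t))) (Set.Ici 0) t

/-- A reparametrized flow is regular if `ρ'` vanishes at some coordinate of `w t` for only
finitely many times `t` in the domain `[0, T)`. -/
def RegularFlow {k : ℕ} (ρ : ℝ → ℝ) (T : ℝ≥0∞) (w : ℝ → Fin k → ℝ) : Prop :=
  {t : ℝ | 0 ≤ t ∧ ENNReal.ofReal t < T ∧ ∃ i, deriv ρ (w t i) = 0}.Finite

/-- The filter of "`t → T` from within `[0,T)`", with `T = ∞` meaning `t → ∞`. -/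
def endFilter (T : ℝ≥0∞) : Filter ℝ :=
  if T = ⊤ then Filter.atTop else nhdsWithin T.toReal (Set.Iio T.toReal)

/-- Entrywise ℓp-norm on `ℝ^k`. -/
def lpNorm {k : ℕ} (p : ℝ) (z : Fin k → ℝ) : ℝ := (∑ i, |z i| ^ p) ^ (1 / p)

/-- Euclidean norm on `ℝ^k`. -/
def euclNorm {k : ℕ} (z : Fin k → ℝ) : ℝ := Real.sqrt (∑ i, (z i) ^ 2)

/-- Bregman divergence associated with `F(z) = ∑ i, H (z i)`, whose gradient is `h = H'`
applied entrywise. -/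
def bregman {k : ℕ} (H h : ℝ → ℝ) (p q : Fin k → ℝ) : ℝ :=
  (∑ i, H (p i)) - (∑ i, H (q i)) - ∑ i, h (q i) * (p i - q i)

/-- Assumption (A3) on the loss function: continuously differentiable, convex in the first
argument, with minimum `0` attained exactly on the diagonal. -/
structure LossA3 {m : ℕ} (L : (Fin m → ℝ) → (Fin m → ℝ) → ℝ) : Prop where
  contDiff : ContDiff ℝ 1 (Function.uncurry L)
  convexOn_fst : ∀ y, ConvexOn ℝ Set.univ fun z => L z y
  nonneg : ∀ z z', 0 ≤ L z z'
  eq_zero_iff : ∀ z z', L z z' = 0 ↔ z = z'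

/-- Assumption (A1) on the link function. -/
structure LinkA1 {m : ℕ} (ρlink : ℝ → ℝ) (y : Fin m → ℝ) : Prop where
  contDiff : ContDiff ℝ 1 ρlink
  injective : Function.Injective ρlink
  mem_image : ∀ j, ∃ x : ℝ, ρlink x = y j

/-- Assumption (A2) on the reparametrization `ρ : ℝ → D` with inverse `ρinv`:
continuously differentiable and invertible, derivative nonzero outside a finite set, and
`([ρ⁻¹]')²` integrable on every compact subset of `D`. -/
structure RepA2 (ρ : ℝ → ℝ) (D : Set ℝ) (ρinv : ℝ → ℝ) : Prop where
  contDiff : ContDiff ℝ 1 ρ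
  mapsTo : ∀ x : ℝ, ρ x ∈ D
  left_inv : ∀ x : ℝ, ρinv (ρ x) = x
  right_inv : ∀ z ∈ D, ρ (ρinv z) = z
  finite_critical : {x : ℝ | deriv ρ x = 0}.Finite
  loc_integrable : ∀ C : Set ℝ, C ⊆ D → IsCompact C →
    MeasureTheory.IntegrableOn (fun z => (deriv ρinv z) ^ 2) C

/-- A function which is continuous on `[a, b]` and has nonpositive derivative outside a finite
set does not increase. -/
lemma le_of_hasDerivAt_nonpos_off_finite {s : Set ℝ} (hs : s.Finite) {f f' : ℝ → ℝ} {a b : ℝ}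
    (hab : a ≤ b) (hf : ContinuousOn f (Icc a b))
    (hd : ∀ x ∈ Ioo a b, x ∉ s → HasDerivAt f (f' x) x ∧ f' x ≤ 0) : f b ≤ f a := by
  induction s, hs using Set.Finite.induction_on generalizing a b with
  | empty =>
    have hanti : AntitoneOn f (Icc a b) := by
      refine antitoneOn_of_deriv_nonpos (convex_Icc a b) hf ?_ ?_
      · intro x hx
        rw [interior_Icc] at hx
        exact (hd x hx (notMem_empty x)).1.differentiableAt.differentiableWithinAt
      · intro x hx
        rw [interior_Icc] at hx
        rw [(hd x hx (notMem_empty x)).1.deriv]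
        exact (hd x hx (notMem_empty x)).2
    exact hanti (left_mem_Icc.2 hab) (right_mem_Icc.2 hab) hab
  | @insert c s _ _ ih =>
    by_cases hc : c ∈ Ioo a b
    · have h₁ : f c ≤ f a := by
        refine ih hc.1.le (hf.mono (Icc_subset_Icc_right hc.2.le)) fun x hx hxs => ?_
        refine hd x ⟨hx.1, hx.2.trans hc.2⟩ ?_
        rw [mem_insert_iff, not_or]
        exact ⟨hx.2.ne, hxs⟩
      have h₂ : f b ≤ f c := by
        refine ih hc.2.le (hf.mono (Icc_subset_Icc_left hc.1.le)) fun x hx hxs => ?_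
        refine hd x ⟨hc.1.trans hx.1, hx.2⟩ ?_
        rw [mem_insert_iff, not_or]
        exact ⟨hx.1.ne', hxs⟩
      exact h₂.trans h₁
    · refine ih hab hf fun x hx hxs => hd x hx ?_
      rw [mem_insert_iff, not_or]
      exact ⟨fun hxc => hc (hxc ▸ hx), hxs⟩

/-- A derivative known on a punctured neighborhood extends to the point by continuity. -/
lemma hasDerivAt_of_eventually_punctured {f g : ℝ → ℝ} {x : ℝ}
    (hd : ∀ᶠ u in 𝓝[≠] x, HasDerivAt f (g u) u) (hf : ContinuousAt f x)
    (hg : ContinuousAt g x) : HasDerivAt f (g x) x := by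
  have hgt : ∀ᶠ u in 𝓝[>] x, HasDerivAt f (g u) u :=
    hd.filter_mono (nhdsWithin_mono x fun u (hu : x < u) => hu.ne')
  have hlt : ∀ᶠ u in 𝓝[<] x, HasDerivAt f (g u) u :=
    hd.filter_mono (nhdsWithin_mono x fun u (hu : u < x) => hu.ne)
  have hdiff : DifferentiableOn ℝ f {u | HasDerivAt f (g u) u} :=
    fun u (hu : HasDerivAt f (g u) u) => hu.differentiableAt.differentiableWithinAt
  have hright : HasDerivWithinAt f (g x) (Ici x) x := by
    refine hasDerivWithinAt_Ici_of_tendsto_deriv hdiff hf.continuousWithinAt hgt ?_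
    refine Tendsto.congr' ?_ (hg.tendsto.mono_left nhdsWithin_le_nhds)
    filter_upwards [hgt] with u hu using hu.deriv.symm
  have hleft : HasDerivWithinAt f (g x) (Iic x) x := by
    refine hasDerivWithinAt_Iic_of_tendsto_deriv hdiff hf.continuousWithinAt hlt ?_
    refine Tendsto.congr' ?_ (hg.tendsto.mono_left nhdsWithin_le_nhds)
    filter_upwards [hlt] with u hu using hu.deriv.symm
  simpa using hleft.union hright

/-- The first order characterization of convexity for differentiable functions. -/
lemma ConvexOn.fderiv_sub_le {E : Type*} [NormedAddCommGroup E] [NormedSpace ℝ E] {f : E → ℝ}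
    (hf : ConvexOn ℝ univ f) {x : E} (hd : DifferentiableAt ℝ f x) (z : E) :
    fderiv ℝ f x (z - x) ≤ f z - f x := by
  have hline : HasDerivAt (fun s : ℝ => f (AffineMap.lineMap x z s)) (fderiv ℝ f x (z - x)) 0 := by
    have hd' : HasFDerivAt f (fderiv ℝ f x) (AffineMap.lineMap x z (0 : ℝ)) := by
      simpa using hd.hasFDerivAt
    exact hd'.comp_hasDerivAt (0 : ℝ) AffineMap.hasDerivAt_lineMap
  have hconv : ConvexOn ℝ univ (fun s : ℝ => f (AffineMap.lineMap x z s)) := by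
    exact hf.comp_affineMap (AffineMap.lineMap x z)
  simpa [slope_def_field] using
    hconv.le_slope_of_hasDerivAt (mem_univ 0) (mem_univ 1) zero_lt_one hline

section Reparametrization

variable {ρ ρinv : ℝ → ℝ} {D : Set ℝ} {h H : ℝ → ℝ} {S : Set ℝ}

lemma RepA2.range_eq (hA2 : RepA2 ρ D ρinv) : range ρ = D := by
  ext z
  constructor
  · rintro ⟨x, rfl⟩
    exact hA2.mapsTo x
  · exact fun hz => ⟨ρinv z, hA2.right_inv z hz⟩

lemma RepA2.ordConnected (hA2 : RepA2 ρ D ρinv) : D.OrdConnected := by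
  rw [← hA2.range_eq]
  exact (isPreconnected_range hA2.contDiff.continuous).ordConnected

lemma RepA2.hasDerivAt (hA2 : RepA2 ρ D ρinv) (x : ℝ) : HasDerivAt ρ (deriv ρ x) x :=
  (hA2.contDiff.differentiable one_ne_zero x).hasDerivAt

lemma RepA2.deriv_inv (hA2 : RepA2 ρ D ρinv) {x : ℝ} (hx : deriv ρ x ≠ 0) :
    deriv ρinv (ρ x) = (deriv ρ x)⁻¹ := by
  have hstrict : HasStrictDerivAt ρ (deriv ρ x) x :=
    hA2.contDiff.contDiffAt.hasStrictDerivAt one_ne_zero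
  exact (hstrict.to_local_left_inverse hx
    (Eventually.of_forall hA2.left_inv)).hasDerivAt.deriv

/-- Along the reparametrization, the mirror map `h` has derivative `1 / ρ'` at every noncritical
point. -/
lemma RepA2.hasDerivAt_mirror_comp (hA2 : RepA2 ρ D ρinv) (hS : S.Finite)
    (hcont : ContinuousOn h D)
    (hderiv : ∀ z ∈ D \ S, HasDerivWithinAt h ((deriv ρinv z) ^ 2) D z)
    {x : ℝ} (hx : deriv ρ x ≠ 0) : HasDerivAt (fun u => h (ρ u)) (deriv ρ x)⁻¹ x := by
  have hρ' : Continuous (deriv ρ) := hA2.contDiff.continuous_deriv le_rfl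
  have hinj : Function.Injective ρ := Function.LeftInverse.injective hA2.left_inv
  have hfin : (ρ ⁻¹' S).Finite := hS.preimage hinj.injOn
  have hnotS : ∀ᶠ u in 𝓝[≠] x, u ∉ ρ ⁻¹' S := by
    have : (ρ ⁻¹' S \ {x})ᶜ ∈ 𝓝 x :=
      (hfin.subset sdiff_subset).isClosed.isOpen_compl.mem_nhds (by simp)
    filter_upwards [mem_nhdsWithin_of_mem_nhds this, self_mem_nhdsWithin] with u hu hux huS
    exact hu ⟨huS, hux⟩
  refine hasDerivAt_of_eventually_punctured (g := fun u => (deriv ρ u)⁻¹) ?_ ?_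
    (hρ'.continuousAt.inv₀ hx)
  · have hne : ∀ᶠ u in 𝓝[≠] x, deriv ρ u ≠ 0 :=
      (hρ'.continuousAt.eventually_ne hx).filter_mono nhdsWithin_le_nhds
    filter_upwards [hnotS, hne] with u huS hu
    have hcomp := (hderiv (ρ u) ⟨hA2.mapsTo u, huS⟩).comp_hasDerivAt u (hA2.hasDerivAt u)
      (Eventually.of_forall hA2.mapsTo)
    rw [hA2.deriv_inv hu] at hcomp
    refine hcomp.congr_deriv ?_
    field_simp
  · exact (hcont.comp_continuous hA2.contDiff.continuous hA2.mapsTo).continuousAt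

lemma monotoneOn_of_hasDerivWithinAt_sq (hD : D.OrdConnected) (hS : S.Finite) {g : ℝ → ℝ}
    (hcont : ContinuousOn h D) (hderiv : ∀ z ∈ D \ S, HasDerivWithinAt h ((g z) ^ 2) D z) :
    MonotoneOn h D := by
  intro p hp q hq hpq
  have hsub : Icc p q ⊆ D := hD.out hp hq
  have := le_of_hasDerivAt_nonpos_off_finite (f := fun z => -h z) (f' := fun z => -(g z) ^ 2)
    hS hpq (hcont.mono hsub).neg fun z hz hzS => by
      have hzD : D ∈ 𝓝 z := mem_of_superset (Icc_mem_nhds hz.1 hz.2) hsub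
      exact ⟨((hderiv z ⟨mem_of_mem_nhds hzD, hzS⟩).hasDerivAt hzD).neg,
        neg_nonpos.2 (sq_nonneg _)⟩
  exact neg_le_neg_iff.1 this

/-- The scalar Bregman divergence of an antiderivative of a monotone function is nonnegative. -/
lemma mul_sub_le_sub_of_monotoneOn_deriv (hD : D.OrdConnected) (hmono : MonotoneOn h D)
    (hH : ∀ z ∈ D, HasDerivWithinAt H (h z) D z) {p q : ℝ} (hp : p ∈ D) (hq : q ∈ D) :
    h q * (p - q) ≤ H p - H q := by
  have key : ∀ {a b : ℝ}, a ∈ D → b ∈ D → a < b →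
      ∃ c ∈ D, a ≤ c ∧ c ≤ b ∧ h c * (b - a) = H b - H a := by
    intro a b ha hb hab
    have hsub : Icc a b ⊆ D := hD.out ha hb
    obtain ⟨c, hc, hc'⟩ := exists_hasDerivAt_eq_slope H h hab
      (fun z hz => (hH z (hsub hz)).continuousWithinAt.mono hsub) fun z hz =>
        (hH z (hsub (Ioo_subset_Icc_self hz))).hasDerivAt
          (mem_of_superset (Icc_mem_nhds hz.1 hz.2) hsub)
    refine ⟨c, hsub (Ioo_subset_Icc_self hc), hc.1.le, hc.2.le, ?_⟩
    rw [hc', div_mul_cancel₀ _ (sub_pos.2 hab).ne']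
  rcases lt_trichotomy p q with hpq | rfl | hpq
  · obtain ⟨c, hcD, -, hcq, hc⟩ := key hp hq hpq
    nlinarith [hmono hcD hq hcq]
  · simp
  · obtain ⟨c, hcD, hqc, -, hc⟩ := key hq hp hpq
    nlinarith [hmono hq hcD hqc]

lemma bregman_nonneg {k : ℕ} (hD : D.OrdConnected) (hmono : MonotoneOn h D)
    (hH : ∀ z ∈ D, HasDerivWithinAt H (h z) D z) {p q : Fin k → ℝ} (hp : ∀ i, p i ∈ D)
    (hq : ∀ i, q i ∈ D) : 0 ≤ bregman H h p q := by
  rw [bregman, ← Finset.sum_sub_distrib, ← Finset.sum_sub_distrib]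
  exact Finset.sum_nonneg fun i _ =>
    sub_nonneg.2 (mul_sub_le_sub_of_monotoneOn_deriv hD hmono hH (hp i) (hq i))

/-- Evolution of the Bregman divergence to a fixed point along a curve. -/
lemma hasDerivAt_bregman {k : ℕ} (hA2 : RepA2 ρ D ρinv) (hS : S.Finite)
    (hcont : ContinuousOn h D)
    (hderiv : ∀ z ∈ D \ S, HasDerivWithinAt h ((deriv ρinv z) ^ 2) D z)
    (hH : ∀ z ∈ D, HasDerivWithinAt H (h z) D z) (p : Fin k → ℝ) {w : ℝ → Fin k → ℝ}
    {v : Fin k → ℝ} {t : ℝ} (hw : HasDerivAt w v t) (hne : ∀ i, deriv ρ (w t i) ≠ 0) :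
    HasDerivAt (fun s => bregman H h p fun i => ρ (w s i))
      (-∑ i, (deriv ρ (w t i))⁻¹ * v i * (p i - ρ (w t i))) t := by
  rw [hasDerivAt_pi] at hw
  have hρw : ∀ i, HasDerivAt (fun s => ρ (w s i)) (deriv ρ (w t i) * v i) t := fun i =>
    (hA2.hasDerivAt (w t i)).comp t (hw i)
  have hHw : ∀ i, HasDerivAt (fun s => H (ρ (w s i)))
      (h (ρ (w t i)) * (deriv ρ (w t i) * v i)) t := fun i =>
    (hH (ρ (w t i)) (hA2.mapsTo _)).comp_hasDerivAt t (hρw i)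
      (Eventually.of_forall fun _ => hA2.mapsTo _)
  have hhw : ∀ i, HasDerivAt (fun s => h (ρ (w s i))) ((deriv ρ (w t i))⁻¹ * v i) t := fun i =>
    HasDerivAt.comp t (h₂ := fun u => h (ρ u))
      (hA2.hasDerivAt_mirror_comp hS hcont hderiv (hne i)) (hw i)
  have hsum := ((HasDerivAt.fun_sum fun i (_ : i ∈ Finset.univ) => hHw i).const_sub
    (∑ i, H (p i))).fun_sub (HasDerivAt.fun_sum fun i (_ : i ∈ Finset.univ) =>
      (hhw i).fun_mul ((hρw i).const_sub (p i)))
  refine hsum.congr_deriv ?_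
  simp only [← Finset.sum_neg_distrib, ← Finset.sum_sub_distrib]
  exact Finset.sum_congr rfl fun i _ => by ring

lemma continuousOn_bregman {k : ℕ} (hA2 : RepA2 ρ D ρinv) (hcont : ContinuousOn h D)
    (hHcont : ContinuousOn H D) (p : Fin k → ℝ) {w : ℝ → Fin k → ℝ} {s : Set ℝ}
    (hw : ContinuousOn w s) :
    ContinuousOn (fun t => bregman H h p fun i => ρ (w t i)) s := by
  have hwi : ∀ i, ContinuousOn (fun t => w t i) s := continuousOn_pi.1 hw
  have hρw : ∀ i, ContinuousOn (fun t => ρ (w t i)) s := fun i =>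
    hA2.contDiff.continuous.comp_continuousOn (hwi i)
  have hHw : ∀ i, ContinuousOn (fun t => H (ρ (w t i))) s := fun i =>
    hHcont.comp (hρw i) fun _ _ => hA2.mapsTo _
  have hhw : ∀ i, ContinuousOn (fun t => h (ρ (w t i))) s := fun i =>
    hcont.comp (hρw i) fun _ _ => hA2.mapsTo _
  exact (continuousOn_const.sub (continuousOn_finsetSum _ fun i _ => hHw i)).sub
    (continuousOn_finsetSum _ fun i _ => (hhw i).mul (continuousOn_const.sub (hρw i)))

end Reparametrization

section Loss

variable {N M : ℕ} {L : (Fin M → ℝ) → (Fin M → ℝ) → ℝ}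

lemma LossA3.differentiable (hA3 : LossA3 L) (y : Fin M → ℝ) :
    Differentiable ℝ fun z => L z y := by
  have : ContDiff ℝ 1 fun z => L z y :=
    hA3.contDiff.comp (contDiff_id.prodMk contDiff_const)
  exact this.differentiable one_ne_zero

/-- Chain rule for the reparametrized loss. -/
lemma hasFDerivAt_reparametrized_loss (hA3 : LossA3 L) (A : Matrix (Fin M) (Fin N) ℝ)
    (y : Fin M → ℝ) {ρ : ℝ → ℝ} (hρ : ∀ u, HasDerivAt ρ (deriv ρ u) u) (x : Fin N → ℝ) :
    HasFDerivAt (fun z : Fin N → ℝ => L (A.mulVec fun i => ρ (z i)) y)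
      ((fderiv ℝ (fun z => L z y) (A.mulVec fun i => ρ (x i))).comp
        ((LinearMap.toContinuousLinearMap A.mulVecLin).comp
          (ContinuousLinearMap.pi fun i =>
            deriv ρ (x i) • ContinuousLinearMap.proj (R := ℝ) (φ := fun _ : Fin N => ℝ) i))) x := by
  have hentry : HasFDerivAt (fun (z : Fin N → ℝ) i => ρ (z i))
      (ContinuousLinearMap.pi fun i =>
        deriv ρ (x i) • ContinuousLinearMap.proj (R := ℝ) (φ := fun _ : Fin N => ℝ) i) x :=
    hasFDerivAt_pi.2 fun i =>
      (hρ (x i)).comp_hasFDerivAt x (hasFDerivAt_apply (𝕜 := ℝ) i x)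
  have hlin := (LinearMap.toContinuousLinearMap A.mulVecLin).hasFDerivAt.comp x hentry
  exact HasFDerivAt.comp x (g := fun z => L z y)
    (hA3.differentiable y (A.mulVec fun i => ρ (x i))).hasFDerivAt hlin

lemma grad_reparametrized_loss (hA3 : LossA3 L) (A : Matrix (Fin M) (Fin N) ℝ)
    (y : Fin M → ℝ) {ρ : ℝ → ℝ} (hρ : ∀ u, HasDerivAt ρ (deriv ρ u) u) (x : Fin N → ℝ)
    (i : Fin N) :
    grad (fun z : Fin N → ℝ => L (A.mulVec fun i => ρ (z i)) y) x i =
      deriv ρ (x i) * fderiv ℝ (fun z => L z y) (A.mulVec fun i => ρ (x i))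
        (A.mulVec (Pi.single i 1)) := by
  rw [grad, (hasFDerivAt_reparametrized_loss hA3 A y hρ x).fderiv]
  have hpi : (ContinuousLinearMap.pi fun j =>
      deriv ρ (x j) • ContinuousLinearMap.proj (R := ℝ) (φ := fun _ : Fin N => ℝ) j)
        (Pi.single i 1) = deriv ρ (x i) • (Pi.single i 1 : Fin N → ℝ) := by
    ext j
    rcases eq_or_ne j i with rfl | hj
    · simp
    · simp [hj]
  rw [ContinuousLinearMap.comp_apply, ContinuousLinearMap.comp_apply, hpi, map_smul, map_smul,
    smul_eq_mul]
  rfl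

lemma map_eq_sum_single_mul {E : Type*} [AddCommGroup E] [Module ℝ E] (φ : (Fin N → ℝ) →ₗ[ℝ] E)
    (v : Fin N → ℝ) : φ v = ∑ i, v i • φ (Pi.single i 1) := by
  rw [LinearMap.pi_apply_eq_sum_univ φ v]
  refine Finset.sum_congr rfl fun i _ => ?_
  congr 2
  ext j
  simp [Pi.single_apply, eq_comm]

/-- A gradient flow dissipates its objective. -/
lemma hasDerivAt_comp_gradFlow {k : ℕ} {F : (Fin k → ℝ) → ℝ} {w : ℝ → Fin k → ℝ} {t : ℝ}
    (hF : DifferentiableAt ℝ F (w t)) (hw : HasDerivAt w (-grad F (w t)) t) :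
    HasDerivAt (fun s => F (w s)) (-∑ i, grad F (w t) i ^ 2) t := by
  refine (hF.hasFDerivAt.comp_hasDerivAt t hw).congr_deriv ?_
  have := map_eq_sum_single_mul (fderiv ℝ F (w t)).toLinearMap (-grad F (w t))
  simp only [ContinuousLinearMap.coe_coe] at this
  rw [this, ← Finset.sum_neg_distrib]
  exact Finset.sum_congr rfl fun i _ => by simp only [grad, Pi.neg_apply, smul_eq_mul]; ring

end Loss

/-- General `O(1/t)` convergence rate of the loss along the reparametrized
gradient flow. -/
theorem statement6 {N M : ℕ} (ρ ρinv : ℝ → ℝ) (D : Set ℝ) (hA2 : RepA2 ρ D ρinv)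
    (A : Matrix (Fin M) (Fin N) ℝ) (y : Fin M → ℝ)
    (L : (Fin M → ℝ) → (Fin M → ℝ) → ℝ) (hA3 : LossA3 L)
    (zt0 : Fin N → ℝ) (hzt0mem : ∀ i, zt0 i ∈ D) (hzt0 : A.mulVec zt0 = y)
    (h H : ℝ → ℝ) (S : Set ℝ) (hS : S.Finite)
    (hcont : ContinuousOn h D) (hHcont : ContinuousOn H D)
    (hderiv : ∀ z ∈ D \ S, HasDerivWithinAt h ((deriv ρinv z) ^ 2) D z)
    (hHderiv : ∀ z ∈ D, HasDerivWithinAt H (h z) D z)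
    (T : ℝ≥0∞) (hT : 0 < T) (w : ℝ → Fin N → ℝ)
    (hflow : IsGradFlowOn (fun z => L (A.mulVec fun i => ρ (z i)) y) T w)
    (hreg : RegularFlow ρ T w) :
    (∀ t : ℝ, 0 < t → ENNReal.ofReal t < T →
      L (A.mulVec fun i => ρ (w t i)) y ≤
        bregman H h zt0 (fun i => ρ (w 0 i)) / t) ∧
    (T = ⊤ →
      Tendsto (fun t => L (A.mulVec fun i => ρ (w t i)) y) atTop (𝓝 0)) := by
  set ℓ : ℝ → ℝ := fun t => L (A.mulVec fun i => ρ (w t i)) y with hℓ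
  set B : ℝ → ℝ := fun t => bregman H h zt0 fun i => ρ (w t i) with hB
  have hD := hA2.ordConnected
  have hmono : MonotoneOn h D := monotoneOn_of_hasDerivWithinAt_sq hD hS hcont hderiv
  have hrate : ∀ t : ℝ, 0 < t → ENNReal.ofReal t < T → ℓ t ≤ B 0 / t := by
    intro t ht htT
    have hlt : ∀ s ≤ t, ENNReal.ofReal s < T := fun s hs =>
      (ENNReal.ofReal_le_ofReal hs).trans_lt htT
    have hw : ContinuousOn w (Icc 0 t) := fun s hs =>
      (hflow s hs.1 (hlt s hs.2)).continuousWithinAt.mono Icc_subset_Ici_self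
    have hdiff : Differentiable ℝ fun z : Fin N → ℝ => L (A.mulVec fun i => ρ (z i)) y :=
      fun x => (hasFDerivAt_reparametrized_loss hA3 A y hA2.hasDerivAt x).differentiableAt
    have hBcont : ContinuousOn B (Icc 0 t) := continuousOn_bregman hA2 hcont hHcont zt0 hw
    have hℓcont : ContinuousOn ℓ (Icc 0 t) := hdiff.continuous.comp_continuousOn hw
    have hle := le_of_hasDerivAt_nonpos_off_finite (f := fun s => B s + s * ℓ s)
      (f' := fun s => deriv (fun s => B s + s * ℓ s) s) hreg ht.le
      (hBcont.add (continuousOn_id.mul hℓcont)) fun s hs hsreg => by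
        have hne : ∀ i, deriv ρ (w s i) ≠ 0 := fun i hi =>
          hsreg ⟨hs.1.le, hlt s hs.2.le, i, hi⟩
        have hws := (hflow s hs.1.le (hlt s hs.2.le)).hasDerivAt (Ici_mem_nhds hs.1)
        have hBd := hasDerivAt_bregman hA2 hS hcont hderiv hHderiv zt0 hws hne
        have hℓd : HasDerivAt ℓ _ s := hasDerivAt_comp_gradFlow (hdiff (w s)) hws
        have hsum := hBd.fun_add ((hasDerivAt_id' s).fun_mul hℓd)
        refine ⟨hsum.differentiableAt.hasDerivAt, ?_⟩
        rw [hsum.deriv]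
        have hconv := (hA3.convexOn_fst y).fderiv_sub_le
          (hA3.differentiable y (A.mulVec fun i => ρ (w s i))) y
        rw [(hA3.eq_zero_iff y y).2 rfl] at hconv
        have hlinear : -∑ i, (deriv ρ (w s i))⁻¹ *
            (-grad (fun z : Fin N → ℝ => L (A.mulVec fun i => ρ (z i)) y) (w s)) i *
              (zt0 i - ρ (w s i)) =
            fderiv ℝ (fun z => L z y) (A.mulVec fun i => ρ (w s i))
              (y - A.mulVec fun i => ρ (w s i)) := by
          rw [← hzt0, ← Matrix.mulVec_sub, hzt0]
          have hmap := map_eq_sum_single_mul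
            ((fderiv ℝ (fun z => L z y) (A.mulVec fun i => ρ (w s i))).toLinearMap ∘ₗ
              A.mulVecLin) (zt0 - fun i => ρ (w s i))
          simp only [LinearMap.comp_apply, ContinuousLinearMap.coe_coe,
            Matrix.mulVecLin_apply] at hmap
          rw [hmap, ← Finset.sum_neg_distrib]
          refine Finset.sum_congr rfl fun i _ => ?_
          rw [Pi.neg_apply, grad_reparametrized_loss hA3 A y hA2.hasDerivAt, Pi.sub_apply,
            smul_eq_mul]
          have := hne i
          field_simp
        rw [hlinear]
        have hsq : 0 ≤ s * ∑ i, grad (fun z : Fin N → ℝ =>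
            L (A.mulVec fun i => ρ (z i)) y) (w s) i ^ 2 :=
          mul_nonneg hs.1.le (Finset.sum_nonneg fun i _ => sq_nonneg _)
        linarith
    have hnonneg : 0 ≤ B t :=
      bregman_nonneg hD hmono hHderiv hzt0mem fun i => hA2.mapsTo _
    rw [le_div_iff₀ ht]
    simp only [zero_mul, add_zero] at hle
    linarith
  refine ⟨hrate, fun hTtop => ?_⟩
  refine squeeze_zero' (Eventually.of_forall fun t => hA3.nonneg _ _) ?_
    (tendsto_const_nhds.div_atTop tendsto_id : Tendsto (fun t : ℝ => B 0 / t) atTop (𝓝 0))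
  filter_upwards [eventually_gt_atTop 0] with t ht
  exact hrate t ht (hTtop ▸ ENNReal.ofReal_lt_top)
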